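/- Let ⋆ and ∗ be two continuous t-norms and let p: X = ∏ᵢ₌₁ⁿ Xᵢ → [0,1]ⁿ be an n-player game with compacta Xᵢ and continuous p. Then there exist possibility capacities (μ₁,…,μₙ) ∈ M_∪X₁ × … × M_∪Xₙ such that the belief system (μ₁*,…,μₙ*), where μᵢ* = ⊛_{j≠i} μⱼ is the tensor product generated by ∗, is an equilibrium under uncertainty with respect to ⋆, i.e. μᵢ*( X₋ᵢ ∖ ∏_{j≠i} R^⋆ⱼ(μⱼ*) ) = 0 for every i. -/

import Mathlib

open Set TopologicalSpace

universe u v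

/-- A (upper-semicontinuous) capacity on a topological space `X`:
a normalized monotone set function on the closed subsets, upper semicontinuous
in the sense of Zarichnyi–Nykyforchyn. -/
structure Capacity (X : Type u) [TopologicalSpace X] : Type u where
  toFun : Closeds X → ℝ
  empty' : toFun ⊥ = 0
  univ' : toFun ⊤ = 1
  mono' : ∀ F G : Closeds X, F ≤ G → toFun F ≤ toFun G
  usc' : ∀ (F : Closeds X) (a : ℝ), toFun F < a →
    ∃ O : Set X, IsOpen O ∧ (F : Set X) ⊆ O ∧ ∀ B : Closeds X, (B : Set X) ⊆ O → toFun B < a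

namespace Capacity

variable {X : Type u} [TopologicalSpace X]

/-- Value of a capacity on (the closure of) an arbitrary set; on closed sets this is
the value of the capacity. -/
def cval (ν : Capacity X) (A : Set X) : ℝ := ν.toFun ⟨closure A, isClosed_closure⟩

/-- The sup-extension of a capacity to open sets:
`ν(U) = sup {ν K : K closed, K ⊆ U}`. -/
noncomputable def oval (ν : Capacity X) (U : Set X) : ℝ :=
  sSup {r : ℝ | ∃ K : Closeds X, (K : Set X) ⊆ U ∧ ν.toFun K = r}

end Capacity

/-- The topology on the space `MX` of capacities, generated by the subbase
`O₋(F,a) = {c : c(F) < a}` (`F` closed) and `O₊(U,a) = {c : c(U) > a}` (`U` open). -/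
instance capacityTopology (X : Type u) [TopologicalSpace X] : TopologicalSpace (Capacity X) :=
  TopologicalSpace.generateFrom
    ({S | ∃ (F : Closeds X) (a : ℝ), a ∈ Icc (0:ℝ) 1 ∧
        S = {c : Capacity X | c.toFun F < a}} ∪
     {S | ∃ U : Set X, IsOpen U ∧ ∃ a ∈ Icc (0:ℝ) 1,
        S = {c : Capacity X | a < c.oval U}})

/-- A possibility capacity: `ν(A ∪ B) = max (ν A) (ν B)` on closed sets. -/
def IsPossibility {X : Type u} [TopologicalSpace X] (ν : Capacity X) : Prop :=
  ∀ A B : Closeds X, ν.toFun (A ⊔ B) = max (ν.toFun A) (ν.toFun B)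

/-- A necessity capacity: `ν(A ∩ B) = min (ν A) (ν B)` on closed sets. -/
def IsNecessity {X : Type u} [TopologicalSpace X] (ν : Capacity X) : Prop :=
  ∀ A B : Closeds X, ν.toFun (A ⊓ B) = min (ν.toFun A) (ν.toFun B)

/-- A triangular norm on `[0,1]`. -/
structure Tnorm : Type where
  toFun : ℝ → ℝ → ℝ
  mem' : ∀ s ∈ Icc (0:ℝ) 1, ∀ t ∈ Icc (0:ℝ) 1, toFun s t ∈ Icc (0:ℝ) 1
  comm' : ∀ s ∈ Icc (0:ℝ) 1, ∀ t ∈ Icc (0:ℝ) 1, toFun s t = toFun t s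
  assoc' : ∀ s ∈ Icc (0:ℝ) 1, ∀ t ∈ Icc (0:ℝ) 1, ∀ r ∈ Icc (0:ℝ) 1,
    toFun (toFun s t) r = toFun s (toFun t r)
  mono' : ∀ s₁ ∈ Icc (0:ℝ) 1, ∀ s₂ ∈ Icc (0:ℝ) 1, ∀ t₁ ∈ Icc (0:ℝ) 1, ∀ t₂ ∈ Icc (0:ℝ) 1,
    s₁ ≤ s₂ → t₁ ≤ t₂ → toFun s₁ t₁ ≤ toFun s₂ t₂
  one' : ∀ s ∈ Icc (0:ℝ) 1, toFun s 1 = s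

/-- Continuity of a t-norm (on the unit square). -/
def Tnorm.Cont (star : Tnorm) : Prop :=
  ContinuousOn (fun q : ℝ × ℝ => star.toFun q.1 q.2) (Icc 0 1 ×ˢ Icc 0 1)

/-- The t-normed (fuzzy) integral `∫^{∨∗} f dν = sup { ν(f⁻¹[t,1]) ∗ t : t ∈ [0,1] }`. -/
noncomputable def tInt {X : Type u} [TopologicalSpace X] (star : Tnorm) (ν : Capacity X) (f : X → ℝ) : ℝ :=
  sSup {r : ℝ | ∃ t ∈ Icc (0:ℝ) 1, r = star.toFun (ν.cval (f ⁻¹' Icc t 1)) t}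
/-- Expected payoff of player `i` choosing pure strategy `x`, given belief `ν` about the
opponents' strategy combinations: `P*ᵢ(x, ν) = ∫^{∨∗}_{X₋ᵢ} pᵢ(x, ·) dν`. -/
noncomputable def Pexp {n : ℕ} (X : Fin (n+1) → Type u) [∀ j, TopologicalSpace (X j)]
    (p : (∀ j, X j) → Fin (n+1) → ℝ) (star : Tnorm) (i : Fin (n+1))
    (x : X i) (ν : Capacity (∀ k : Fin n, X (i.succAbove k))) : ℝ :=
  tInt star ν fun y => p (i.insertNth x y) i

/-- The best response set of player `i` given belief `ν`:
`R*ᵢ(ν) = {x : P*ᵢ(x, ν) = max_z P*ᵢ(z, ν)}`. -/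
noncomputable def BestResp {n : ℕ} (X : Fin (n+1) → Type u) [∀ j, TopologicalSpace (X j)]
    (p : (∀ j, X j) → Fin (n+1) → ℝ) (star : Tnorm) (i : Fin (n+1))
    (ν : Capacity (∀ k : Fin n, X (i.succAbove k))) : Set (X i) :=
  {x : X i | Pexp X p star i x ν = sSup (Set.range fun z : X i => Pexp X p star i z ν)}
/-- The iterated product of a list of reals under a t-norm (empty product is `1`,
the neutral element). -/
def Tnorm.listProd (ast : Tnorm) : List ℝ → ℝ
  | [] => 1
  | a :: l => ast.toFun a (ast.listProd l)
/-- `IsPossTensorOff ast X μ i τ` says that `τ ∈ M_∪(X₋ᵢ)` is the tensor product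
`⊛_{j ≠ i} μⱼ` (generated by the t-norm `ast`) of the possibility capacities `μ j`,
`j ≠ i`: the possibility capacity whose density at `x₋ᵢ` is `∗_{j≠i} [μⱼ](xⱼ)`. -/
def IsPossTensorOff {n : ℕ} (X : Fin (n+1) → Type u) [∀ j, TopologicalSpace (X j)]
    (ast : Tnorm) (μ : ∀ j, Capacity (X j)) (i : Fin (n+1))
    (τ : Capacity (∀ k : Fin n, X (i.succAbove k))) : Prop :=
  ∀ B : Set (∀ k : Fin n, X (i.succAbove k)), IsClosed B →
    τ.cval B = sSup ((fun y : ∀ k : Fin n, X (i.succAbove k) =>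
      ast.listProd ((List.finRange n).map fun k => (μ (i.succAbove k)).cval {y k})) '' B)

section BW
open MeasureTheory

/-- polynomial dependence of the integral of det(1+tA) -/
theorem bw_poly {N : ℕ} (B : Set (EuclideanSpace ℝ (Fin N))) (hB : IsCompact B)
    (A : EuclideanSpace ℝ (Fin N) → (EuclideanSpace ℝ (Fin N) →L[ℝ] EuclideanSpace ℝ (Fin N)))
    (hA : ContinuousOn A B) :
    ∃ P : Polynomial ℝ, ∀ t : ℝ, ∫ x in B, (1 + t • A x).det = P.eval t := by
  let b := (EuclideanSpace.basisFun (Fin N) ℝ).toBasis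
  let M : EuclideanSpace ℝ (Fin N) → Matrix (Fin N) (Fin N) ℝ := fun x =>
    LinearMap.toMatrix b b (A x : EuclideanSpace ℝ (Fin N) →ₗ[ℝ] EuclideanSpace ℝ (Fin N))
  have hM : ∀ i j, ContinuousOn (fun x => M x i j) B := by
    intro i j
    have : (fun x => M x i j) = fun x => (A x (b j)) i := by
      funext x
      simp [M, b, LinearMap.toMatrix_apply]
    rw [this]
    have h1 : ContinuousOn (fun x => A x (b j)) B := hA.clm_apply continuousOn_const
    exact ((EuclideanSpace.proj i : EuclideanSpace ℝ (Fin N) →L[ℝ] ℝ).continuous).comp_continuousOn h1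
  have hdet : ∀ (t : ℝ) x, (1 + t • A x).det =
      ∑ σ : Equiv.Perm (Fin N), ∑ S ∈ (Finset.univ : Finset (Fin N)).powerset,
        t ^ (Finset.univ \ S).card * (((Equiv.Perm.sign σ : ℤ) : ℝ) *
          ((∏ i ∈ S, (1 : Matrix (Fin N) (Fin N) ℝ) (σ i) i) * ∏ i ∈ Finset.univ \ S, M x (σ i) i)) := by
    intro t x
    have h1 : (1 + t • A x).det = (1 + t • M x).det := by
      rw [ContinuousLinearMap.det, ← LinearMap.det_toMatrix b]
      congr 1
      change LinearMap.toMatrix b b ((1 : EuclideanSpace ℝ (Fin N) →ₗ[ℝ] EuclideanSpace ℝ (Fin N)) +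
        t • (A x : EuclideanSpace ℝ (Fin N) →ₗ[ℝ] EuclideanSpace ℝ (Fin N))) = _
      rw [map_add, map_smul, LinearMap.toMatrix_one]
    rw [h1, Matrix.det_apply']
    refine Finset.sum_congr rfl fun σ _ => ?_
    simp only [Matrix.add_apply, Matrix.smul_apply, smul_eq_mul]
    rw [Finset.prod_add, Finset.mul_sum]
    refine Finset.sum_congr rfl fun S _ => ?_
    rw [Finset.prod_mul_distrib, Finset.prod_const]
    ring
  refine ⟨∑ σ : Equiv.Perm (Fin N), ∑ S ∈ (Finset.univ : Finset (Fin N)).powerset,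
        Polynomial.X ^ (Finset.univ \ S).card * Polynomial.C (∫ x in B, (((Equiv.Perm.sign σ : ℤ) : ℝ) *
          ((∏ i ∈ S, (1 : Matrix (Fin N) (Fin N) ℝ) (σ i) i) * ∏ i ∈ Finset.univ \ S, M x (σ i) i))), ?_⟩
  intro t
  have hint : ∀ (σ : Equiv.Perm (Fin N)) (S : Finset (Fin N)), Integrable (fun x => t ^ (Finset.univ \ S).card * (((Equiv.Perm.sign σ : ℤ) : ℝ) *
          ((∏ i ∈ S, (1 : Matrix (Fin N) (Fin N) ℝ) (σ i) i) * ∏ i ∈ Finset.univ \ S, M x (σ i) i))) (volume.restrict B) := by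
    intro σ S
    apply ContinuousOn.integrableOn_compact hB
    refine continuousOn_const.mul (continuousOn_const.mul (continuousOn_const.mul ?_))
    exact continuousOn_finsetProd _ fun i _ => hM _ _
  simp_rw [hdet]
  rw [integral_finsetSum _ fun σ _ => integrable_finsetSum _ fun S _ => hint σ S]
  rw [Polynomial.eval_finsetSum]
  refine Finset.sum_congr rfl fun σ _ => ?_
  rw [integral_finsetSum _ fun S _ => hint σ S, Polynomial.eval_finsetSum]
  refine Finset.sum_congr rfl fun S _ => ?_
  rw [integral_const_mul, Polynomial.eval_mul, Polynomial.eval_pow, Polynomial.eval_X,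
    Polynomial.eval_C]

/-- no `C¹` retraction, analytic form -/
theorem bw_noretract {N : ℕ} (r : EuclideanSpace ℝ (Fin N) → EuclideanSpace ℝ (Fin N))
    (hr : ∀ x, ‖x‖ ≤ 1 → ContDiffAt ℝ 1 r x)
    (hr1 : ∀ x, ‖x‖ ≤ 1 → ∀ᶠ y in nhds x, ‖r y‖ ^ 2 = 1)
    (hr2 : ∀ x, ‖x‖ = 1 → r x = x) : False := by
  let E := EuclideanSpace ℝ (Fin N)
  let B : Set E := Metric.closedBall 0 1
  have hB : IsCompact B := isCompact_closedBall 0 1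
  have memB : ∀ x : E, x ∈ B ↔ ‖x‖ ≤ 1 := fun x => by simp [B]
  let h : E → E := fun x => r x - x
  have hh : ∀ x ∈ B, ContDiffAt ℝ 1 h x := fun x hx => (hr x ((memB x).1 hx)).sub contDiffAt_id
  have hhd : ∀ x ∈ B, HasFDerivAt h (fderiv ℝ h x) x := fun x hx =>
    ((hh x hx).differentiableAt (by norm_num)).hasFDerivAt
  have hA : ContinuousOn (fderiv ℝ h) B := fun x hx =>
    ((hh x hx).continuousAt_fderiv (by norm_num)).continuousWithinAt
  obtain ⟨P, hP⟩ := bw_poly B hB (fderiv ℝ h) hA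
  obtain ⟨C0, hC0⟩ := hB.exists_bound_of_continuousOn hA
  let C := max C0 1
  have hC : ∀ x ∈ B, ‖fderiv ℝ h x‖ ≤ C := fun x hx => (hC0 x hx).trans (le_max_left _ _)
  have hCpos : 0 < C := lt_of_lt_of_le one_pos (le_max_right _ _)
  have hLip : ∀ x ∈ B, ∀ y ∈ B, ‖h x - h y‖ ≤ C * ‖x - y‖ := fun x hx y hy =>
    (convex_closedBall (0:E) 1).norm_image_sub_le_of_norm_hasFDerivWithin_le
      (fun z hz => (hhd z hz).hasFDerivWithinAt) hC hy hx
  -- radial projection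
  let ρ : E → E := fun x => (max 1 ‖x‖)⁻¹ • x
  have hρB : ∀ x, ρ x ∈ B := by
    intro x
    rw [memB, norm_smul, norm_inv, Real.norm_of_nonneg (by positivity)]
    rw [inv_mul_le_iff₀ (by positivity)]
    simp
  have hρid : ∀ x ∈ B, ρ x = x := by
    intro x hx
    simp [ρ, max_eq_left ((memB x).1 hx)]
  have hρs : ∀ x, x ∉ B → ‖ρ x‖ = 1 := by
    intro x hx
    rw [memB, not_le] at hx
    simp only [ρ]
    rw [max_eq_right hx.le, norm_smul, norm_inv, norm_norm]
    exact inv_mul_cancel₀ (by positivity)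
  have hρL : ∀ x y, ‖ρ x - ρ y‖ ≤ 2 * ‖x - y‖ := by
    intro x y
    have ha : 1 ≤ max 1 ‖x‖ := le_max_left _ _
    have hb : 1 ≤ max 1 ‖y‖ := le_max_left _ _
    have hby : ‖y‖ ≤ max 1 ‖y‖ := le_max_right _ _
    have hab : |max 1 ‖y‖ - max 1 ‖x‖| ≤ ‖x - y‖ := by
      have := abs_max_sub_max_le_abs ‖y‖ ‖x‖ 1
      rw [max_comm 1, max_comm 1]
      refine this.trans ?_
      rw [norm_sub_rev]
      exact abs_norm_sub_norm_le y x
    generalize hax : max 1 ‖x‖ = a at *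
    generalize hbx : max 1 ‖y‖ = b at *
    have e : ρ x - ρ y = a⁻¹ • (x - y) + (a⁻¹ * b⁻¹ * (b - a)) • y := by
      simp only [ρ, hax, hbx]
      have : a⁻¹ * b⁻¹ * (b - a) = a⁻¹ - b⁻¹ := by field_simp
      rw [this]; module
    rw [e]
    refine (norm_add_le _ _).trans ?_
    rw [norm_smul, norm_smul, Real.norm_eq_abs, Real.norm_eq_abs, abs_mul, abs_mul,
      abs_of_pos (by positivity : 0 < a⁻¹), abs_of_pos (by positivity : 0 < b⁻¹)]
    have ha1 : a⁻¹ ≤ 1 := inv_le_one_of_one_le₀ ha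
    have h1 : a⁻¹ * ‖x - y‖ ≤ ‖x - y‖ := mul_le_of_le_one_left (norm_nonneg _) ha1
    have h2 : b⁻¹ * ‖y‖ ≤ 1 := by rw [inv_mul_le_iff₀ (by positivity)]; simpa using hby
    have h3 : a⁻¹ * b⁻¹ * |b - a| * ‖y‖ ≤ ‖x - y‖ := by
      calc a⁻¹ * b⁻¹ * |b - a| * ‖y‖ = (a⁻¹ * |b - a|) * (b⁻¹ * ‖y‖) := by ring
        _ ≤ (1 * ‖x - y‖) * 1 := by gcongr
        _ = _ := by ring
    linarith
  -- det positive near identity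
  have hdetc : ∀ᶠ M : E →L[ℝ] E in nhds 0, 0 < (1 + M).det := by
    have : ContinuousAt (fun M : E →L[ℝ] E => (1 + M).det) 0 :=
      (ContinuousLinearMap.continuous_det.comp (by fun_prop)).continuousAt
    apply this.eventually_const_lt
    have h1 : (1 + (0 : E →L[ℝ] E)).det = 1 := by
      rw [add_zero]
      exact LinearMap.det_id
    change 0 < (1 + (0 : E →L[ℝ] E)).det
    rw [h1]
    exact one_pos
  obtain ⟨δ, hδ, hδ'⟩ := Metric.eventually_nhds_iff.1 hdetc
  have hsmall : ∀ t : ℝ, 0 < t → t * (2 * C) < 1 → t * C < δ → P.eval t = (volume B).toReal := by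
    intro t ht ht1 ht2
    rw [← hP]
    have hdp : ∀ x ∈ B, 0 < (1 + t • fderiv ℝ h x).det := by
      intro x hx
      apply hδ'
      rw [dist_zero_right, norm_smul, Real.norm_of_nonneg ht.le]
      exact lt_of_le_of_lt (by gcongr; exact hC x hx) ht2
    let F : E → E := fun x => x + t • h x
    have hF : ∀ x ∈ B, HasFDerivWithinAt F (1 + t • fderiv ℝ h x) B x := fun x hx =>
      ((hasFDerivAt_id x).add ((hhd x hx).const_smul t)).hasFDerivWithinAt
    have hinj : InjOn F B := by
      intro x hx y hy hxy
      have e : x - y = t • (h y - h x) := by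
        have : x + t • h x = y + t • h y := hxy
        rw [smul_sub]
        rw [sub_eq_sub_iff_add_eq_add, this, add_comm]
      have h1 : ‖x - y‖ ≤ t * C * ‖x - y‖ := by
        conv_lhs => rw [e, norm_smul, Real.norm_of_nonneg ht.le]
        rw [mul_assoc, norm_sub_rev x y]
        gcongr
        exact hLip y hy x hx
      have h2 : ‖x - y‖ = 0 := by
        by_contra hne
        have : 0 < ‖x - y‖ := lt_of_le_of_ne (norm_nonneg _) (Ne.symm hne)
        nlinarith
      exact sub_eq_zero.1 (norm_eq_zero.1 h2)
    have himg : F '' B = B := by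
      apply Subset.antisymm
      · rintro _ ⟨x, hx, rfl⟩
        have e : F x = (1 - t) • x + t • r x := by simp only [F, h]; module
        have ht1' : t ≤ 1 := by
          have : (1:ℝ) ≤ C := le_max_right _ _
          nlinarith
        have hrx : r x ∈ B := by
          rw [memB]
          have := (hr1 x ((memB x).1 hx)).self_of_nhds
          nlinarith [norm_nonneg (r x)]
        rw [e]
        exact (convex_closedBall (0:E) 1) hx hrx (by linarith) ht.le (by ring)
      · intro y hy
        have hct : ContractingWith (Real.toNNReal (t * (2 * C))) (fun x => y - t • h (ρ x)) := by
          refine ⟨?_, ?_⟩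
          · rw [← NNReal.coe_lt_coe, Real.coe_toNNReal _ (by positivity)]; simpa using ht1
          · apply LipschitzWith.of_dist_le_mul
            intro a b
            rw [Real.coe_toNNReal _ (by positivity), dist_eq_norm, dist_eq_norm]
            have : y - t • h (ρ a) - (y - t • h (ρ b)) = t • (h (ρ b) - h (ρ a)) := by module
            rw [this, norm_smul, Real.norm_of_nonneg ht.le]
            have h1 := hLip (ρ b) (hρB b) (ρ a) (hρB a)
            have h2 := hρL b a
            rw [norm_sub_rev a b]
            calc t * ‖h (ρ b) - h (ρ a)‖ ≤ t * (C * (2 * ‖b - a‖)) := by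
                  gcongr; exact h1.trans (by gcongr)
              _ = _ := by ring
        have hfix := hct.fixedPoint_isFixedPt
        set x := ContractingWith.fixedPoint _ hct
        have hx : y - t • h (ρ x) = x := hfix
        have hxB : x ∈ B := by
          by_contra hn
          have h0 : h (ρ x) = 0 := by
            simp only [h]; rw [hr2 _ (hρs x hn), sub_self]
          rw [h0, smul_zero, sub_zero] at hx
          exact hn (hx ▸ hy)
        refine ⟨x, hxB, ?_⟩
        rw [hρid x hxB] at hx
        simp only [F]
        exact (sub_eq_iff_eq_add.1 hx).symm
    have := integral_image_eq_integral_abs_det_fderiv_smul volume hB.measurableSet hF hinj (fun _ => (1:ℝ))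
    rw [himg] at this
    simp only [smul_eq_mul, mul_one, integral_const] at this
    rw [setIntegral_congr_fun hB.measurableSet (fun x hx => (abs_of_pos (hdp x hx)).symm), ← this]
    simp [Measure.real]
  have hconst : P = Polynomial.C (volume B).toReal := by
    apply Polynomial.eq_of_infinite_eval_eq
    have hd : 0 < min (1 / (2 * C)) (δ / C) := by positivity
    refine (Set.Ioo_infinite hd).mono ?_
    rintro t ⟨ht0, ht⟩
    rw [lt_min_iff] at ht
    simp only [mem_ofPred_eq, Polynomial.eval_C]
    exact hsmall t ht0 ((lt_div_iff₀ (by positivity)).1 ht.1) ((lt_div_iff₀ (by positivity)).1 ht.2)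
  have h1 := hP 1
  rw [hconst, Polynomial.eval_C] at h1
  have hz : ∀ x ∈ B, (1 + (1:ℝ) • fderiv ℝ h x).det = 0 := by
    intro x hx
    have hx' := (memB x).1 hx
    have hrd : HasFDerivAt r (fderiv ℝ r x) x := ((hr x hx').differentiableAt (by norm_num)).hasFDerivAt
    have e : 1 + (1:ℝ) • fderiv ℝ h x = fderiv ℝ r x := by
      have := (hrd.sub (hasFDerivAt_id x)).fderiv
      have h2 : fderiv ℝ h x = fderiv ℝ r x - ContinuousLinearMap.id ℝ E := this
      rw [h2, one_smul]
      exact add_sub_cancel _ _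
    rw [e]
    by_contra hne
    have hsurj : ∃ v, fderiv ℝ r x v = r x := by
      have := LinearMap.equivOfDetNeZero (fderiv ℝ r x : E →ₗ[ℝ] E) hne
      have hu : IsUnit (LinearMap.det (fderiv ℝ r x : E →ₗ[ℝ] E)) := isUnit_iff_ne_zero.2 hne
      have := (LinearMap.equivOfIsUnitDet hu).surjective (r x)
      obtain ⟨v, hv⟩ := this
      exact ⟨v, by simpa using hv⟩
    obtain ⟨v, hv⟩ := hsurj
    have hn := hrd.norm_sq
    have hc : HasFDerivAt (fun y => ‖r y‖ ^ 2) (0 : E →L[ℝ] ℝ) x :=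
      (hasFDerivAt_const (1:ℝ) x).congr_of_eventuallyEq (hr1 x hx')
    have := congrArg (fun L => L v) (hn.unique hc)
    simp [hv] at this
    have h3 := (hr1 x hx').self_of_nhds
    simp [this] at h3
  rw [setIntegral_congr_fun hB.measurableSet hz] at h1
  rw [integral_zero] at h1
  have hpos : 0 < volume B := Metric.measure_closedBall_pos volume 0 one_pos
  have hfin : volume B < ⊤ := hB.measure_lt_top
  have := ENNReal.toReal_pos hpos.ne' hfin.ne
  linarith

theorem bw_unit {N : ℕ} (f : EuclideanSpace ℝ (Fin N) → EuclideanSpace ℝ (Fin N))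
    (hf : Continuous f) (hf1 : ∀ x, ‖f x‖ ≤ 1) : ∃ x, f x = x := by
  by_contra! hne
  obtain ⟨x0, hx0, hmin⟩ := (isCompact_closedBall (0 : EuclideanSpace ℝ (Fin N)) 1).exists_isMinOn
    ⟨0, by simp⟩ (f := fun x => ‖f x - x‖) (by fun_prop)
  set δ := ‖f x0 - x0‖ with hδd
  have hδ : 0 < δ := norm_pos_iff.2 (sub_ne_zero.2 (hne x0))
  have hmin' : ∀ x, ‖x‖ ≤ 1 → δ ≤ ‖f x - x‖ := fun x hx => hmin (by simpa using hx)
  let ε := δ / 3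
  have hε : 0 < ε := by positivity
  obtain ⟨G, hG, hGf, -⟩ := hf.exists_contDiff_approx 1 (ε := fun _ => ε) continuous_const (fun _ => hε)
  have hGn : ∀ x, ‖G x‖ < 1 + ε := by
    intro x
    have h1 := hGf x
    rw [dist_eq_norm] at h1
    have h2 := norm_add_le (G x - f x) (f x)
    rw [sub_add_cancel] at h2
    linarith [hf1 x]
  let g : EuclideanSpace ℝ (Fin N) → EuclideanSpace ℝ (Fin N) := fun x => (1 + ε)⁻¹ • G x
  have hg : ContDiff ℝ 1 g := by
    have hG' : ContDiff ℝ 1 G := by exact_mod_cast hG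
    exact hG'.const_smul _
  have hgn : ∀ x, ‖g x‖ < 1 := by
    intro x
    simp only [g]
    rw [norm_smul, norm_inv, Real.norm_of_nonneg (by positivity), inv_mul_lt_iff₀ (by positivity)]
    simpa using hGn x
  have hgx : ∀ x, ‖x‖ ≤ 1 → x - g x ≠ 0 := by
    intro x hx h0
    have e : f x - x = (f x - G x) + ε • g x := by
      have h1 : x = g x := sub_eq_zero.1 h0
      have h2 : G x = (1 + ε) • g x := by
        simp only [g]; rw [smul_smul, mul_inv_cancel₀ (by positivity), one_smul]
      rw [h2]; nth_rewrite 2 [h1]; module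
    have h3 := hmin' x hx
    rw [e] at h3
    have h4 := norm_add_le (f x - G x) (ε • g x)
    rw [norm_smul, Real.norm_of_nonneg hε.le] at h4
    have h5 := hGf x
    rw [dist_comm, dist_eq_norm] at h5
    have h6 : ε * ‖g x‖ ≤ ε := by nlinarith [hgn x]
    have : δ = 3 * ε := by simp only [ε]; ring
    linarith
  let u : EuclideanSpace ℝ (Fin N) → EuclideanSpace ℝ (Fin N) := fun x => x - g x
  have hu : ContDiff ℝ 1 u := contDiff_id.sub hg
  let D : EuclideanSpace ℝ (Fin N) → ℝ := fun x => (inner ℝ x (u x)) ^ 2 + ‖u x‖ ^ 2 * (1 - ‖x‖ ^ 2)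
  have hD : ContDiff ℝ 1 D :=
    ((contDiff_id.inner ℝ hu).pow 2).add ((hu.norm_sq ℝ).mul (contDiff_const.sub (contDiff_id.norm_sq ℝ)))
  have hin : ∀ x, ‖x‖ = 1 → 0 < inner ℝ x (u x) := by
    intro x hx
    simp only [u]
    rw [inner_sub_right, real_inner_self_eq_norm_sq, hx]
    have := real_inner_le_norm x (g x)
    rw [hx] at this
    linarith [hgn x]
  have hDpos : ∀ x, ‖x‖ ≤ 1 → 0 < D x := by
    intro x hx
    rcases hx.lt_or_eq with h | h
    · have h1 : 0 < ‖u x‖ := norm_pos_iff.2 (hgx x hx)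
      have h2 : 0 < 1 - ‖x‖ ^ 2 := by nlinarith [norm_nonneg x]
      simp only [D]; positivity
    · have := hin x h
      simp only [D, h]
      norm_num
      positivity
  let l : EuclideanSpace ℝ (Fin N) → ℝ := fun x => (√(D x) - inner ℝ x (u x)) / ‖u x‖ ^ 2
  apply bw_noretract (fun x => x + l x • u x)
  · intro x hx
    have h1 : ContDiffAt ℝ 1 l x := by
      apply ContDiffAt.div
      · exact (hD.contDiffAt.sqrt (hDpos x hx).ne').sub (contDiff_id.inner ℝ hu).contDiffAt
      · exact (hu.norm_sq ℝ).contDiffAt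
      · have := norm_pos_iff.2 (hgx x hx)
        positivity
    exact contDiffAt_id.add (h1.smul hu.contDiffAt)
  · intro x hx
    have h1 : ∀ᶠ y in nhds x, 0 < D y := hD.continuous.continuousAt.eventually_const_lt (hDpos x hx)
    have h2 : ∀ᶠ y in nhds x, u y ≠ 0 := hu.continuous.continuousAt.eventually_ne (hgx x hx)
    filter_upwards [h1, h2] with y hy1 hy2
    rw [norm_add_sq_real, inner_smul_right, norm_smul, mul_pow, Real.norm_eq_abs, sq_abs]
    have hs := Real.sq_sqrt hy1.le
    have ha : ‖u y‖ ^ 2 ≠ 0 := by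
      have := norm_pos_iff.2 hy2
      positivity
    simp only [l]
    simp only [D] at hs ⊢
    generalize √(inner ℝ y (u y) ^ 2 + ‖u y‖ ^ 2 * (1 - ‖y‖ ^ 2)) = s at *
    generalize inner ℝ y (u y) = b at *
    generalize ‖u y‖ ^ 2 = a at *
    generalize ‖y‖ ^ 2 = c at *
    field_simp
    linear_combination hs
  · intro x hx
    have h0 := hin x hx
    have : l x = 0 := by
      simp only [l, D, hx]
      norm_num
      rw [Real.sqrt_sq h0.le]; simp
    simp [this]

theorem bw_cube {ι : Type*} [Fintype ι] (F : (ι → ℝ) → (ι → ℝ)) (hF : Continuous F)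
    (hF1 : ∀ x i, F x i ∈ Icc (0:ℝ) 1) : ∃ x, F x = x := by
  classical
  let e := Fintype.equivFin ι
  let N := Fintype.card ι
  let R : ℝ := N + 1
  have hR : 0 < R := by positivity
  let f : EuclideanSpace ℝ (Fin N) → EuclideanSpace ℝ (Fin N) := fun x =>
    WithLp.toLp 2 (fun k => R⁻¹ * F (fun i => R * x (e i)) (e.symm k))
  have hf : Continuous f := by
    apply (PiLp.continuous_toLp 2 _).comp
    refine continuous_pi fun k => continuous_const.mul ?_
    refine (continuous_apply _).comp (hF.comp (continuous_pi fun i => continuous_const.mul ?_))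
    exact (EuclideanSpace.proj (e i) : EuclideanSpace ℝ (Fin N) →L[ℝ] ℝ).continuous
  have hf1 : ∀ x, ‖f x‖ ≤ 1 := by
    intro x
    rw [EuclideanSpace.norm_eq]
    refine Real.sqrt_le_iff.2 ⟨zero_le_one, ?_⟩
    rw [one_pow]
    have : ∀ k, ‖f x k‖ ^ 2 ≤ R⁻¹ := by
      intro k
      have h := hF1 (fun i => R * x (e i)) (e.symm k)
      have hR1 : R⁻¹ ≤ 1 := inv_le_one_of_one_le₀ (by simp [R])
      have hR0 : 0 < R⁻¹ := by positivity
      simp only [f]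
      rw [norm_mul, Real.norm_of_nonneg hR0.le, Real.norm_of_nonneg h.1]
      have h3 : R⁻¹ * F (fun i => R * x (e i)) (e.symm k) ≤ R⁻¹ := mul_le_of_le_one_right hR0.le h.2
      have h4 : 0 ≤ R⁻¹ * F (fun i => R * x (e i)) (e.symm k) := mul_nonneg hR0.le h.1
      nlinarith
    refine (Finset.sum_le_sum fun k _ => this k).trans ?_
    simp only [Finset.sum_const, Finset.card_univ, Fintype.card_fin, nsmul_eq_mul]
    rw [← div_eq_mul_inv, div_le_one hR]
    simp [R]
  obtain ⟨x, hx⟩ := bw_unit f hf hf1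
  refine ⟨fun i => R * x (e i), ?_⟩
  funext i
  have := congrArg (fun y : EuclideanSpace ℝ (Fin N) => y (e i)) hx
  simp only [f, Equiv.symm_apply_apply] at this
  rw [← this, ← mul_assoc, mul_inv_cancel₀ hR.ne', one_mul]

theorem fin_equilibrium {ι : Type*} [Fintype ι] (Y : ι → Type*) [∀ i, Fintype (Y i)]
    [∀ i, Nonempty (Y i)] (T : ∀ i, Y i → (∀ i, Y i → ℝ) → ℝ) (hT : ∀ i x, Continuous (T i x)) :
    ∃ d : ∀ i, Y i → ℝ, (∀ i x, d i x ∈ Icc (0:ℝ) 1) ∧ (∀ i, ∃ x, d i x = 1) ∧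
      ∀ i x, 0 < d i x → ∀ z, T i z d ≤ T i x d := by
  classical
  let mT : ∀ i, (∀ i, Y i → ℝ) → ℝ := fun i d => Finset.univ.sup' Finset.univ_nonempty (fun z => T i z d)
  let mD : ∀ i, (∀ i, Y i → ℝ) → ℝ := fun i d => Finset.univ.sup' Finset.univ_nonempty (fun z => d i z)
  have hmT : ∀ i, Continuous (mT i) := fun i =>
    Continuous.finset_sup'_apply _ fun z _ => hT i z
  have hmD : ∀ i, Continuous (mD i) := fun i =>
    Continuous.finset_sup'_apply _ fun z _ => by fun_prop
  let cu : ((Σ i, Y i) → ℝ) → ∀ i, Y i → ℝ := fun z i x => z ⟨i, x⟩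
  have hcu : Continuous cu := by fun_prop
  let F : ((Σ i, Y i) → ℝ) → ((Σ i, Y i) → ℝ) := fun z a =>
    max 0 (min 1 (z a + (T a.1 a.2 (cu z) - mT a.1 (cu z)) + (1 - mD a.1 (cu z))))
  have hF : Continuous F := by
    refine continuous_pi fun a => continuous_const.max (continuous_const.min ?_)
    exact ((continuous_apply a).add (((hT _ _).comp hcu).sub ((hmT _).comp hcu))).add
      (continuous_const.sub ((hmD _).comp hcu))
  have hF1 : ∀ x a, F x a ∈ Icc (0:ℝ) 1 := fun x a =>
    ⟨le_max_left _ _, max_le zero_le_one (min_le_left _ _)⟩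
  obtain ⟨z, hz⟩ := bw_cube F hF hF1
  set d := cu z with hd
  have hz' : ∀ i x, d i x = max 0 (min 1 (d i x + (T i x d - mT i d) + (1 - mD i d))) := by
    intro i x
    have := congrFun hz ⟨i, x⟩
    exact this.symm
  have h01 : ∀ i x, d i x ∈ Icc (0:ℝ) 1 := by
    intro i x; rw [hz']; exact ⟨le_max_left _ _, max_le zero_le_one (min_le_left _ _)⟩
  have hTle : ∀ i x, T i x d ≤ mT i d := fun i x => Finset.le_sup' (fun z => T i z d) (Finset.mem_univ x)
  have hDle : ∀ i x, d i x ≤ mD i d := fun i x => Finset.le_sup' (fun z => d i z) (Finset.mem_univ x)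
  have hDm : ∀ i, mD i d = 1 := by
    intro i
    by_contra hne
    have hle : mD i d ≤ 1 := Finset.sup'_le _ _ fun x _ => (h01 i x).2
    have hlt := lt_of_le_of_ne hle hne
    obtain ⟨x, -, hx⟩ := Finset.exists_mem_eq_sup' (Finset.univ_nonempty (α := Y i)) (fun z => T i z d)
    have h1 := hz' i x
    have hx' : mT i d = T i x d := hx
    rw [hx', sub_self, add_zero] at h1
    have h2 : d i x < max 0 (min 1 (d i x + (1 - mD i d))) :=
      lt_max_of_lt_right (lt_min (lt_of_le_of_lt (hDle i x) hlt) (by linarith))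
    linarith
  refine ⟨d, h01, ?_, ?_⟩
  · intro i
    obtain ⟨x, -, hx⟩ := Finset.exists_mem_eq_sup' (Finset.univ_nonempty (α := Y i)) (fun z => d i z)
    exact ⟨x, by rw [← hDm i]; exact hx.symm⟩
  · intro i x hx w
    by_contra! hlt
    have h1 := hz' i x
    rw [hDm, sub_self, add_zero] at h1
    have h2 : T i x d - mT i d < 0 := by linarith [hTle i w]
    have h3 : max 0 (min 1 (d i x + (T i x d - mT i d))) < d i x :=
      max_lt hx (lt_of_le_of_lt (min_le_right _ _) (by linarith))
    linarith

end BW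

section Aux
open Filter Topology

/-- clamping to the unit interval -/
noncomputable def cl01 (s : ℝ) : ℝ := max 0 (min s 1)

theorem cl01_mem (s : ℝ) : cl01 s ∈ Icc (0:ℝ) 1 :=
  ⟨le_max_left _ _, max_le zero_le_one (min_le_right _ _)⟩

theorem cl01_of_mem {s : ℝ} (hs : s ∈ Icc (0:ℝ) 1) : cl01 s = s := by
  simp [cl01, min_eq_left hs.2, max_eq_right hs.1]

theorem cl01_mono {s t : ℝ} (h : s ≤ t) : cl01 s ≤ cl01 t :=
  max_le_max le_rfl (min_le_min h le_rfl)

theorem cl01_cont : Continuous cl01 := by unfold cl01; fun_prop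

theorem Tnorm.zero_left (T : Tnorm) {t : ℝ} (ht : t ∈ Icc (0:ℝ) 1) : T.toFun 0 t = 0 := by
  have h0 : (0:ℝ) ∈ Icc (0:ℝ) 1 := by simp
  have h1 : (1:ℝ) ∈ Icc (0:ℝ) 1 := by simp
  apply le_antisymm _ (T.mem' 0 h0 t ht).1
  calc T.toFun 0 t ≤ T.toFun 0 1 := T.mono' 0 h0 0 h0 t ht 1 h1 le_rfl ht.2
    _ = 0 := T.one' 0 h0

theorem Tnorm.zero_right (T : Tnorm) {t : ℝ} (ht : t ∈ Icc (0:ℝ) 1) : T.toFun t 0 = 0 := by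
  rw [T.comm' t ht 0 (by simp), T.zero_left ht]

/-- t-norm extended to the plane by clamping -/
noncomputable def Tnorm.ex (T : Tnorm) (s t : ℝ) : ℝ := T.toFun (cl01 s) (cl01 t)

theorem Tnorm.ex_mem (T : Tnorm) (s t : ℝ) : T.ex s t ∈ Icc (0:ℝ) 1 :=
  T.mem' _ (cl01_mem s) _ (cl01_mem t)

theorem Tnorm.ex_of_mem (T : Tnorm) {s t : ℝ} (hs : s ∈ Icc (0:ℝ) 1) (ht : t ∈ Icc (0:ℝ) 1) :
    T.ex s t = T.toFun s t := by rw [Tnorm.ex, cl01_of_mem hs, cl01_of_mem ht]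

theorem Tnorm.ex_mono (T : Tnorm) {s s' t t' : ℝ} (h : s ≤ s') (h' : t ≤ t') :
    T.ex s t ≤ T.ex s' t' :=
  T.mono' _ (cl01_mem _) _ (cl01_mem _) _ (cl01_mem _) _ (cl01_mem _) (cl01_mono h) (cl01_mono h')

theorem Tnorm.ex_cont (T : Tnorm) (hT : T.Cont) : Continuous fun q : ℝ × ℝ => T.ex q.1 q.2 := by
  have : Continuous fun q : ℝ × ℝ => ((cl01 q.1, cl01 q.2) : ℝ × ℝ) :=
    (cl01_cont.comp continuous_fst).prodMk (cl01_cont.comp continuous_snd)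
  exact ContinuousOn.comp_continuous hT this fun q => ⟨cl01_mem _, cl01_mem _⟩

/-- iterated product, clamped -/
noncomputable def Tnorm.lp (T : Tnorm) {n : ℕ} (L : List (Fin n)) (s : Fin n → ℝ) : ℝ :=
  T.listProd (L.map fun k => cl01 (s k))

theorem Tnorm.lp_mem (T : Tnorm) {n : ℕ} (L : List (Fin n)) (s : Fin n → ℝ) :
    T.lp L s ∈ Icc (0:ℝ) 1 := by
  induction L with
  | nil => simp [Tnorm.lp, Tnorm.listProd]
  | cons a L ih => exact T.mem' _ (cl01_mem _) _ ih

theorem Tnorm.lp_cons (T : Tnorm) {n : ℕ} (a : Fin n) (L : List (Fin n)) (s : Fin n → ℝ) :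
    T.lp (a :: L) s = T.ex (s a) (T.lp L s) := by
  rw [Tnorm.ex, cl01_of_mem (T.lp_mem L s)]
  rfl

theorem Tnorm.lp_cont (T : Tnorm) (hT : T.Cont) {n : ℕ} (L : List (Fin n)) :
    Continuous (T.lp L) := by
  induction L with
  | nil => exact continuous_const
  | cons a L ih =>
    have : T.lp (a :: L) = fun s => T.ex (s a) (T.lp L s) := by funext s; exact T.lp_cons a L s
    rw [this]
    exact (T.ex_cont hT).comp ((continuous_apply a).prodMk ih)

theorem Tnorm.lp_mono (T : Tnorm) {n : ℕ} (L : List (Fin n)) {s s' : Fin n → ℝ} (h : ∀ k, s k ≤ s' k) :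
    T.lp L s ≤ T.lp L s' := by
  induction L with
  | nil => exact le_rfl
  | cons a L ih => rw [T.lp_cons, T.lp_cons]; exact T.ex_mono (h a) ih

theorem Tnorm.lp_zero (T : Tnorm) {n : ℕ} (L : List (Fin n)) (s : Fin n → ℝ) (k : Fin n) (hk : k ∈ L)
    (h : s k = 0) : T.lp L s = 0 := by
  have h0 : cl01 0 = 0 := cl01_of_mem (by simp)
  induction L with
  | nil => simp at hk
  | cons a L ih =>
    rw [T.lp_cons, Tnorm.ex]
    rcases List.mem_cons.1 hk with rfl | hk
    · rw [h, h0, T.zero_left (cl01_mem _)]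
    · rw [ih hk, h0, T.zero_right (cl01_mem _)]

theorem Tnorm.lp_one (T : Tnorm) {n : ℕ} (L : List (Fin n)) (s : Fin n → ℝ) 
    (h : ∀ k, s k = 1) : T.lp L s = 1 := by
  have h1 : cl01 1 = 1 := cl01_of_mem (by simp)
  induction L with
  | nil => rfl
  | cons a L ih =>
    rw [T.lp_cons, Tnorm.ex, ih, h, h1, T.one' 1 (by simp)]

/-- the pointwise contribution to the expected payoff -/
noncomputable def qf {n : ℕ} (X : Fin (n+1) → Type u) (p : (∀ j, X j) → Fin (n+1) → ℝ) (star ast : Tnorm)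
    (i : Fin (n+1)) (x : X i) (s : Fin n → ℝ) (y : ∀ k : Fin n, X (i.succAbove k)) : ℝ :=
  star.ex (ast.lp (List.finRange n) s) (p (i.insertNth x y) i)

theorem qf_mono {n : ℕ} (X : Fin (n+1) → Type u) (p : (∀ j, X j) → Fin (n+1) → ℝ) (star ast : Tnorm)
    (i : Fin (n+1)) (x : X i) {s s' : Fin n → ℝ} (h : ∀ k, s k ≤ s' k)
    (y : ∀ k : Fin n, X (i.succAbove k)) :
    qf X p star ast i x s y ≤ qf X p star ast i x s' y :=
  star.ex_mono (ast.lp_mono _ h) le_rfl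

theorem qf_cont {n : ℕ} (X : Fin (n+1) → Type u) [∀ j, TopologicalSpace (X j)]
    (p : (∀ j, X j) → Fin (n+1) → ℝ) (hp : Continuous p) (star ast : Tnorm)
    (hstar : star.Cont) (hast : ast.Cont) (i : Fin (n+1)) :
    Continuous fun w : X i × (Fin n → ℝ) × (∀ k : Fin n, X (i.succAbove k)) =>
      qf X p star ast i w.1 w.2.1 w.2.2 := by
  have h1 : Continuous fun w : X i × (Fin n → ℝ) × (∀ k : Fin n, X (i.succAbove k)) =>
      p (i.insertNth w.1 w.2.2) i := by
    refine (continuous_apply i).comp (hp.comp ?_)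
    exact continuous_fst.finInsertNth i (continuous_snd.comp continuous_snd)
  exact (star.ex_cont hstar).comp
    (((ast.lp_cont hast _).comp (continuous_fst.comp continuous_snd)).prodMk h1)

theorem stage1 {n : ℕ} (X : Fin (n+1) → Type u) [∀ j, Nonempty (X j)]
    (p : (∀ j, X j) → Fin (n+1) → ℝ) (star ast : Tnorm) (hstar : star.Cont) (hast : ast.Cont)
    (A : ∀ j, Finset (X j)) :
    ∃ D : ∀ j, X j → ℝ, (∀ j x, D j x ∈ Icc (0:ℝ) 1) ∧ (∀ j, ∃ x, D j x = 1) ∧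
      ∀ j x, 0 < D j x → ∀ z ∈ A j, ∀ y, ∃ y',
        qf X p star ast j z (fun k => D _ (y k)) y ≤ qf X p star ast j x (fun k => D _ (y' k)) y' := by
  classical
  let A' : ∀ j, Finset (X j) := fun j => insert (Classical.arbitrary (X j)) (A j)
  have : ∀ j, Nonempty (A' j) := fun j => ⟨⟨_, Finset.mem_insert_self _ _⟩⟩
  obtain ⟨d, hd1, hd2, hd3⟩ := fin_equilibrium (fun j => (A' j : Type u))
    (fun i x d => Finset.univ.sup' Finset.univ_nonempty
      (fun y : ∀ k : Fin n, A' (i.succAbove k) =>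
        qf X p star ast i x.1 (fun k => d (i.succAbove k) (y k)) (fun k => (y k).1)))
    (by
      intro i x
      refine Continuous.finset_sup'_apply _ fun y _ => ?_
      refine (star.ex_cont hstar).comp (Continuous.prodMk ((ast.lp_cont hast _).comp ?_) continuous_const)
      fun_prop)
  let D : ∀ j, X j → ℝ := fun j x => if h : x ∈ A' j then d j ⟨x, h⟩ else 0
  have hD : ∀ j (x : A' j), D j x.1 = d j x := fun j x => by simp [D, x.2]
  have hD0 : ∀ j x, x ∉ A' j → D j x = 0 := fun j x hx => by simp [D, hx]
  refine ⟨D, ?_, ?_, ?_⟩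
  · intro j x
    by_cases h : x ∈ A' j
    · rw [hD j ⟨x, h⟩]; exact hd1 _ _
    · rw [hD0 j x h]; simp
  · intro j
    obtain ⟨x, hx⟩ := hd2 j
    exact ⟨x.1, by rw [hD]; exact hx⟩
  · intro j x hx z hz y
    by_cases hy : ∀ k, y k ∈ A' (j.succAbove k)
    · have hxA : x ∈ A' j := by
        by_contra h; rw [hD0 j x h] at hx; exact lt_irrefl _ hx
      rw [hD j ⟨x, hxA⟩] at hx
      have h1 := hd3 j ⟨x, hxA⟩ hx ⟨z, Finset.mem_insert_of_mem hz⟩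
      obtain ⟨y', -, hy'⟩ := Finset.exists_mem_eq_sup' (Finset.univ_nonempty (α := ∀ k : Fin n, A' (j.succAbove k)))
        (fun y : ∀ k : Fin n, A' (j.succAbove k) =>
        qf X p star ast j x (fun k => d (j.succAbove k) (y k)) (fun k => (y k).1))
      refine ⟨fun k => (y' k).1, ?_⟩
      simp only [hD]
      rw [← hy']
      refine le_trans ?_ h1
      have h2 := Finset.le_sup' (fun y : ∀ k : Fin n, A' (j.succAbove k) =>
        qf X p star ast j z (fun k => d (j.succAbove k) (y k)) (fun k => (y k).1))
        (Finset.mem_univ (fun k => (⟨y k, hy k⟩ : A' (j.succAbove k))))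
      refine le_trans (le_of_eq ?_) h2
      simp only [← hD]
    · push Not at hy
      obtain ⟨k, hk⟩ := hy
      refine ⟨y, ?_⟩
      have : qf X p star ast j z (fun k => D _ (y k)) y = 0 := by
        rw [qf, ast.lp_zero _ _ k (List.mem_finRange k) (hD0 _ _ hk), Tnorm.ex, cl01_of_mem (by simp),
          star.zero_left (cl01_mem _)]
      rw [this]
      exact (star.ex_mem _ _).1

theorem stage2 {n : ℕ} (X : Fin (n+1) → Type u)
    [∀ j, TopologicalSpace (X j)] [∀ j, CompactSpace (X j)] [∀ j, Nonempty (X j)]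
    (p : (∀ j, X j) → Fin (n+1) → ℝ) (hp : Continuous p)
    (star ast : Tnorm) (hstar : star.Cont) (hast : ast.Cont) :
    ∃ d : ∀ j, X j → ℝ, (∀ j x, d j x ∈ Icc (0:ℝ) 1) ∧ (∀ j, ∃ x, d j x = 1) ∧
      (∀ j, UpperSemicontinuous (d j)) ∧
      ∀ j x, 0 < d j x → ∀ z y, ∀ c < qf X p star ast j z (fun k => d _ (y k)) y, ∃ y',
        c ≤ qf X p star ast j x (fun k => d _ (y' k)) y' := by
  classical
  choose D hD1 hD2 hD3 using stage1 X p star ast hstar hast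
  let U : Ultrafilter (∀ j, Finset (X j)) := Ultrafilter.of atTop
  have hU : (U : Filter (∀ j, Finset (X j))) ≤ atTop := Ultrafilter.of_le _
  let S : ∀ j, X j → Set ℝ := fun j x =>
    {s | s ∈ Icc (0:ℝ) 1 ∧ ∀ V ∈ 𝓝 x, ∀ᶠ A in (U : Filter (∀ j, Finset (X j))), ∃ x' ∈ V, s ≤ D A j x'}
  have hS0 : ∀ j x, (0:ℝ) ∈ S j x := fun j x =>
    ⟨by simp, fun V hV => Eventually.of_forall fun A => ⟨x, mem_of_mem_nhds hV, (hD1 A j x).1⟩⟩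
  have hSb : ∀ j x, BddAbove (S j x) := fun j x => ⟨1, fun s hs => hs.1.2⟩
  let d : ∀ j, X j → ℝ := fun j x => sSup (S j x)
  have hlt : ∀ j x s, s < d j x → ∀ V ∈ 𝓝 x, ∀ᶠ A in (U : Filter (∀ j, Finset (X j))), ∃ x' ∈ V, s ≤ D A j x' := by
    intro j x s hs V hV
    obtain ⟨s', hs', hss⟩ := exists_lt_of_lt_csSup ⟨0, hS0 j x⟩ hs
    filter_upwards [hs'.2 V hV] with A ⟨x', h1, h2⟩
    exact ⟨x', h1, hss.le.trans h2⟩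
  -- limits lie below `d`
  have hlim : ∀ {α : Type u} (W : Ultrafilter α) (a : α → ∀ j, Finset (X j)) (j) (x : α → X j) (x0 : X j) (s : ℝ),
      Tendsto a W U → Tendsto x W (𝓝 x0) → Tendsto (fun w => D (a w) j (x w)) W (𝓝 s) → s ≤ d j x0 := by
    intro α W a j x x0 s ha hx hs
    have hs01 : s ∈ Icc (0:ℝ) 1 := isClosed_Icc.mem_of_tendsto hs (Eventually.of_forall fun w => hD1 _ _ _)
    refine le_of_forall_lt fun s' hs' => ?_
    by_cases h0 : s' < 0
    · exact lt_of_lt_of_le h0 (le_csSup (hSb j x0) (hS0 j x0))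
    obtain ⟨s'', h1, h2⟩ := exists_between hs'
    refine lt_of_lt_of_le h1 (le_csSup (hSb j x0) ⟨⟨by linarith [not_lt.1 h0], by linarith [hs01.2]⟩, ?_⟩)
    intro V hV
    have hev : ∀ᶠ w in (W : Filter α), ∃ x' ∈ V, s'' ≤ D (a w) j x' := by
      filter_upwards [hx hV, hs.eventually_const_lt h2] with w hw1 hw2
      exact ⟨x w, hw1, hw2.le⟩
    have h3 : Ultrafilter.map a W = U := Ultrafilter.coe_le_coe.1 ha
    rw [← h3]
    exact hev
  have hd1 : ∀ j x, d j x ∈ Icc (0:ℝ) 1 := fun j x =>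
    ⟨le_csSup (hSb j x) (hS0 j x), csSup_le ⟨0, hS0 j x⟩ fun s hs => hs.1.2⟩
  refine ⟨d, hd1, ?_, ?_, ?_⟩
  · intro j
    choose x hx using fun A => hD2 A j
    obtain ⟨x0, -, hx0⟩ := isCompact_univ.ultrafilter_le_nhds (Ultrafilter.map x U) (by simp)
    refine ⟨x0, le_antisymm (hd1 j x0).2 ?_⟩
    refine hlim U id j x x0 1 tendsto_id hx0 ?_
    simp only [id, hx]
    exact tendsto_const_nhds
  · intro j x a ha
    obtain ⟨s, h1, h2⟩ := exists_between ha
    have hs : s ∉ S j x := fun h => absurd (le_csSup (hSb j x) h) (not_le.2 h1)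
    have hs01 : 0 ≤ s := (hd1 j x).1.trans h1.le
    by_cases hs1 : 1 < s
    · exact Eventually.of_forall fun x' => lt_of_le_of_lt (hd1 j x').2 (hs1.trans h2)
    have : ¬ ∀ V ∈ 𝓝 x, ∀ᶠ A in (U : Filter (∀ j, Finset (X j))), ∃ x' ∈ V, s ≤ D A j x' :=
      fun h => hs ⟨⟨hs01, not_lt.1 hs1⟩, h⟩
    push Not at this
    obtain ⟨V, hV, hVn⟩ := this
    filter_upwards [eventually_mem_nhds_iff.2 hV] with x' hx'
    refine lt_of_le_of_lt ?_ h2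
    by_contra! hlt'
    have hVn' : ∃ᶠ A in (U : Filter (∀ j, Finset (X j))), ∀ x' ∈ V, D A j x' < s :=
      Filter.Eventually.frequently hVn
    obtain ⟨A, h3, h4⟩ := (hVn'.and_eventually (hlt j x' s hlt' V hx')).exists
    obtain ⟨x'', h5, h6⟩ := h4
    exact absurd h6 (not_le.2 (h3 x'' h5))
  · intro j x hx z y c hc
    have hq := qf_cont X p hp star ast hstar hast j
    -- eventually good opponents profile
    have hge : ∀ᶠ A in (U : Filter (∀ j, Finset (X j))), ∃ y', c ≤ qf X p star ast j z (fun k => D A _ (y' k)) y' := by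
      have h1 : ∀ᶠ ε : ℝ in 𝓝[>] 0, c < qf X p star ast j z (fun k => d _ (y k) - ε) y := by
        have : Continuous fun ε : ℝ => qf X p star ast j z (fun k => d (j.succAbove k) (y k) - ε) y :=
          hq.comp (continuous_const.prodMk (Continuous.prodMk (by fun_prop) continuous_const))
        refine (this.tendsto 0).mono_left nhdsWithin_le_nhds |>.eventually_const_lt ?_
        simpa using hc
      obtain ⟨ε, h2, hε⟩ := (h1.and self_mem_nhdsWithin).exists
      have h3 : ∀ᶠ y' in 𝓝 y, c < qf X p star ast j z (fun k => d _ (y k) - ε) y' := by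
        have : Continuous fun y' => qf X p star ast j z (fun k => d (j.succAbove k) (y k) - ε) y' :=
          hq.comp (continuous_const.prodMk (continuous_const.prodMk continuous_id))
        exact (this.tendsto y).eventually_const_lt h2
      rw [nhds_pi] at h3
      obtain ⟨I, -, V, hV, hVs⟩ := Filter.mem_pi.1 h3
      have h4 : ∀ᶠ A in (U : Filter (∀ j, Finset (X j))), ∀ k, ∃ x' ∈ V k, d _ (y k) - ε ≤ D A (j.succAbove k) x' :=
        eventually_all.2 fun k => hlt _ _ _ (by have : 0 < ε := hε
                                                linarith) _ (hV k)
      filter_upwards [h4] with A hA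
      choose y' hy1 hy2 using hA
      refine ⟨y', ?_⟩
      have h5 : c < qf X p star ast j z (fun k => d _ (y k) - ε) y' := hVs fun k _ => hy1 k
      exact h5.le.trans (qf_mono X p star ast j z hy2 y')
    have hzA : ∀ᶠ A in (U : Filter (∀ j, Finset (X j))), z ∈ A j := by
      apply hU
      filter_upwards [eventually_ge_atTop (fun i => if h : i = j then {h ▸ z} else ∅ : ∀ j, Finset (X j))] with A hA
      have := hA j
      simp at this
      exact this
    have hfr : ∃ᶠ w in (U : Filter (∀ j, Finset (X j))) ×ˢ 𝓝 x,
        ∃ y', c ≤ qf X p star ast j w.2 (fun k => D w.1 _ (y' k)) y' := by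
      intro hev
      obtain ⟨S1, hS1, V, hV, hSV⟩ := Filter.mem_prod_iff.1 hev
      obtain ⟨s, hs0, hs1⟩ := exists_between hx
      have hS1' : ∀ᶠ A in (U : Filter (∀ j, Finset (X j))), A ∈ S1 := hS1
      obtain ⟨A, ⟨⟨hA1, hA2⟩, hA3⟩, hA4⟩ := (((hS1'.and hge).and hzA).and (hlt j x s hs1 V hV)).exists
      obtain ⟨y1, hy1⟩ := hA2
      obtain ⟨x', hx', hDx'⟩ := hA4
      obtain ⟨y2, hy2⟩ := hD3 A j x' (lt_of_lt_of_le hs0 hDx') z hA3 y1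
      exact hSV (Set.mk_mem_prod hA1 hx') ⟨y2, hy1.trans hy2⟩
    have hne := Filter.frequently_iff_neBot.1 hfr
    let W := Ultrafilter.of ((U : Filter (∀ j, Finset (X j))) ×ˢ 𝓝 x ⊓
      𝓟 {w | ∃ y', c ≤ qf X p star ast j w.2 (fun k => D w.1 _ (y' k)) y'})
    have hW := Ultrafilter.of_le ((U : Filter (∀ j, Finset (X j))) ×ˢ 𝓝 x ⊓
      𝓟 {w | ∃ y', c ≤ qf X p star ast j w.2 (fun k => D w.1 _ (y' k)) y'})
    have hWp : (W : Filter _) ≤ (U : Filter (∀ j, Finset (X j))) ×ˢ 𝓝 x := hW.trans inf_le_left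
    have hWq : ∀ᶠ w in (W : Filter ((∀ j, Finset (X j)) × X j)), ∃ y', c ≤ qf X p star ast j w.2 (fun k => D w.1 _ (y' k)) y' :=
      (hW.trans inf_le_right) (mem_principal_self _)
    have hW1 : Tendsto (fun w : (∀ j, Finset (X j)) × X j => w.1) (W : Filter ((∀ j, Finset (X j)) × X j)) (U : Filter (∀ j, Finset (X j))) :=
      Filter.Tendsto.mono_left Filter.tendsto_fst hWp
    have hW2 : Tendsto (fun w : (∀ j, Finset (X j)) × X j => w.2) (W : Filter ((∀ j, Finset (X j)) × X j)) (𝓝 x) :=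
      Filter.Tendsto.mono_left Filter.tendsto_snd hWp
    have : ∃ Y : ((∀ j, Finset (X j)) × X j) → ∀ k : Fin n, X (j.succAbove k), 
        ∀ᶠ w in (W : Filter ((∀ j, Finset (X j)) × X j)), c ≤ qf X p star ast j w.2 (fun k => D w.1 _ (Y w k)) (Y w) := by
      refine ⟨fun w => if h : ∃ y', c ≤ qf X p star ast j w.2 (fun k => D w.1 _ (y' k)) y' then h.choose
        else y, ?_⟩
      filter_upwards [hWq] with w hw
      simp only [hw, dif_pos]
      exact hw.choose_spec
    obtain ⟨Y, hY⟩ := this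
    obtain ⟨y0, -, hy0⟩ := isCompact_univ.ultrafilter_le_nhds (Ultrafilter.map Y W) (by simp)
    obtain ⟨s0, -, hs0⟩ := (isCompact_univ_pi (fun k : Fin n => isCompact_Icc (a := (0:ℝ)) (b := 1))).ultrafilter_le_nhds
      (Ultrafilter.map (fun w => fun k => D w.1 (j.succAbove k) (Y w k)) W)
      (by
        rw [le_principal_iff, Ultrafilter.coe_map, Filter.mem_map]
        exact Filter.mem_of_superset Filter.univ_mem fun w _ => fun k _ => hD1 _ _ _)
    have hy0' : Tendsto Y W (𝓝 y0) := hy0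
    have hs0' : Tendsto (fun w => fun k => D w.1 (j.succAbove k) (Y w k)) W (𝓝 s0) := hs0
    refine ⟨y0, ?_⟩
    have hle : ∀ k, s0 k ≤ d _ (y0 k) := fun k =>
      hlim W Prod.fst _ (fun w => Y w k) (y0 k) (s0 k) hW1 ((tendsto_pi_nhds.1 hy0') k)
        ((tendsto_pi_nhds.1 hs0') k)
    refine le_trans ?_ (qf_mono X p star ast j x hle y0)
    have hT : Tendsto (fun w : (∀ j, Finset (X j)) × X j =>
        qf X p star ast j w.2 (fun k => D w.1 _ (Y w k)) (Y w)) W (𝓝 (qf X p star ast j x s0 y0)) :=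
      (hq.tendsto (x, s0, y0)).comp (hW2.prodMk_nhds (hs0'.prodMk_nhds hy0'))
    exact ge_of_tendsto hT hY

end Aux

section Cap

theorem capOf_le {X : Type u} (d : X → ℝ) (h01 : ∀ x, d x ∈ Icc (0:ℝ) 1) {B : Set X} {x : X} (hx : x ∈ B) : d x ≤ sSup (d '' B) :=
  le_csSup ⟨1, by rintro _ ⟨y, -, rfl⟩; exact (h01 y).2⟩ ⟨x, hx, rfl⟩

/-- possibility capacity of an upper semicontinuous density -/
noncomputable def capOf {X : Type u} [TopologicalSpace X] (d : X → ℝ) (h01 : ∀ x, d x ∈ Icc (0:ℝ) 1)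
    (h1 : ∃ x, d x = 1) (hu : UpperSemicontinuous d) : Capacity X where
  toFun F := sSup (d '' (F : Set X))
  empty' := by simp
  univ' := by
    obtain ⟨x, hx⟩ := h1
    apply le_antisymm
    · exact Real.sSup_le (by rintro _ ⟨y, -, rfl⟩; exact (h01 y).2) zero_le_one
    · exact le_csSup ⟨1, by rintro _ ⟨y, -, rfl⟩; exact (h01 y).2⟩ ⟨x, by simp, hx⟩
  mono' F G h := by
    refine Real.sSup_le ?_ (Real.sSup_nonneg (by rintro _ ⟨y, -, rfl⟩; exact (h01 y).1))
    rintro _ ⟨y, hy, rfl⟩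
    exact le_csSup ⟨1, by rintro _ ⟨y, -, rfl⟩; exact (h01 y).2⟩ ⟨y, h hy, rfl⟩
  usc' F a ha := by
    obtain ⟨b, hb1, hb2⟩ := exists_between ha
    have h0 : 0 ≤ sSup (d '' (F : Set X)) := Real.sSup_nonneg (by rintro _ ⟨y, -, rfl⟩; exact (h01 y).1)
    refine ⟨d ⁻¹' Iio b, hu.isOpen_preimage b, ?_, ?_⟩
    · intro x hx
      have hh : d x ≤ sSup (d '' (F : Set X)) :=
        le_csSup ⟨1, by rintro _ ⟨y, -, rfl⟩; exact (h01 y).2⟩ ⟨x, hx, rfl⟩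
      exact lt_of_le_of_lt hh hb1
    · intro B hB
      refine lt_of_le_of_lt (Real.sSup_le ?_ (h0.trans hb1.le)) hb2
      rintro _ ⟨y, hy, rfl⟩
      exact le_of_lt (hB hy)

variable {X : Type u} [TopologicalSpace X] (d : X → ℝ) (h01 : ∀ x, d x ∈ Icc (0:ℝ) 1)
    (h1 : ∃ x, d x = 1) (hu : UpperSemicontinuous d)

theorem capOf_cval (B : Set X) (hB : IsClosed B) :
    (capOf d h01 h1 hu).cval B = sSup (d '' B) := by
  simp only [Capacity.cval, capOf, Closeds.coe_mk]
  rw [hB.closure_eq]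


theorem capOf_poss : IsPossibility (capOf d h01 h1 hu) := by
  intro A B
  apply le_antisymm
  · refine Real.sSup_le ?_ (le_max_of_le_left (Real.sSup_nonneg (by rintro _ ⟨y, -, rfl⟩; exact (h01 y).1)))
    rintro _ ⟨y, hy, rfl⟩
    rcases hy with hy | hy
    · exact le_max_of_le_left (capOf_le d h01 hy)
    · exact le_max_of_le_right (capOf_le d h01 hy)
  · exact max_le ((capOf d h01 h1 hu).mono' _ _ le_sup_left) ((capOf d h01 h1 hu).mono' _ _ le_sup_right)

theorem capOf_tInt [CompactSpace X] [Nonempty X] (star : Tnorm) (f : X → ℝ) (hf : Continuous f)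
    (hf01 : ∀ x, f x ∈ Icc (0:ℝ) 1) :
    tInt star (capOf d h01 h1 hu) f = sSup (range fun y => star.ex (d y) (f y)) := by
  have hbd : BddAbove (range fun y => star.ex (d y) (f y)) :=
    ⟨1, by rintro _ ⟨y, rfl⟩; exact (star.ex_mem _ _).2⟩
  have hcl : ∀ t, IsClosed (f ⁻¹' Icc t 1) := fun t => isClosed_Icc.preimage hf
  have hm : ∀ B : Set X, sSup (d '' B) ∈ Icc (0:ℝ) 1 := fun B =>
    ⟨Real.sSup_nonneg (by rintro _ ⟨y, -, rfl⟩; exact (h01 y).1),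
      Real.sSup_le (by rintro _ ⟨y, -, rfl⟩; exact (h01 y).2) zero_le_one⟩
  apply le_antisymm
  · refine csSup_le ⟨_, 0, by simp, rfl⟩ ?_
    rintro _ ⟨t, ht, rfl⟩
    rw [capOf_cval d h01 h1 hu _ (hcl t)]
    rcases (f ⁻¹' Icc t 1).eq_empty_or_nonempty with he | hne
    · rw [he, image_empty, Real.sSup_empty, star.zero_left ht]
      exact Real.sSup_nonneg (by rintro _ ⟨y, rfl⟩; exact (star.ex_mem _ _).1)
    · obtain ⟨y, hy, hmax⟩ := (hu.upperSemicontinuousOn _).exists_isMaxOn hne (hcl t).isCompact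
      have hle : sSup (d '' (f ⁻¹' Icc t 1)) ≤ d y :=
        csSup_le (hne.image d) (by rintro _ ⟨w, hw, rfl⟩; exact hmax hw)
      refine le_trans ?_ (le_csSup hbd ⟨y, rfl⟩)
      rw [← star.ex_of_mem (hm _) ht]
      exact star.ex_mono hle hy.1
  · refine csSup_le (range_nonempty _) ?_
    rintro _ ⟨y, rfl⟩
    have hb : BddAbove {r : ℝ | ∃ t ∈ Icc (0:ℝ) 1, r = star.toFun ((capOf d h01 h1 hu).cval (f ⁻¹' Icc t 1)) t} := by
      refine ⟨1, ?_⟩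
      rintro _ ⟨t, ht, rfl⟩
      rw [capOf_cval d h01 h1 hu _ (hcl t)]
      exact (star.mem' _ (hm _) _ ht).2
    refine le_trans ?_ (le_csSup hb ⟨f y, hf01 y, rfl⟩)
    rw [capOf_cval d h01 h1 hu _ (hcl _), ← star.ex_of_mem (hm _) (hf01 y)]
    exact star.ex_mono (capOf_le d h01 ⟨le_rfl, (hf01 y).2⟩) le_rfl

end Cap

theorem lp_usc {n : ℕ} (Z : Fin n → Type u) [∀ k, TopologicalSpace (Z k)] (ast : Tnorm) (hast : ast.Cont)
    (L : List (Fin n)) (d : ∀ k, Z k → ℝ) (hu : ∀ k, UpperSemicontinuous (d k)) :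
    UpperSemicontinuous fun y : ∀ k, Z k => ast.lp L fun k => d k (y k) := by
  intro y a ha
  have h1 : ∀ᶠ ε : ℝ in nhdsWithin 0 (Ioi 0), ast.lp L (fun k => d k (y k) + ε) < a := by
    have : Continuous fun ε : ℝ => ast.lp L (fun k => d k (y k) + ε) :=
      (ast.lp_cont hast L).comp (by fun_prop)
    refine Filter.Tendsto.eventually_lt_const (v := ast.lp L (fun k => d k (y k) + 0)) ?_
      ((this.tendsto 0).mono_left nhdsWithin_le_nhds)
    simpa using ha
  obtain ⟨ε, h2, hε⟩ := (h1.and self_mem_nhdsWithin).exists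
  have hε' : 0 < ε := hε
  have h3 : ∀ᶠ y' in nhds y, ∀ k, d k (y' k) < d k (y k) + ε :=
    Filter.eventually_all.2 fun k =>
      (continuous_apply k).continuousAt.eventually (hu k (y k) _ (by linarith))
  filter_upwards [h3] with y' hy'
  exact lt_of_le_of_lt (ast.lp_mono L fun k => (hy' k).le) h2

/-- for any `n`-player game with (nonempty) compacta `Xᵢ` and continuous
payoffs in `[0,1]`, and continuous t-norms `⋆` and `∗`, there exist possibility
capacities `μᵢ ∈ M_∪Xᵢ` whose tensor products `μᵢ* = ⊛_{j≠i} μⱼ` (generated by `∗`)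
form an equilibrium under uncertainty with respect to `⋆`:
`μᵢ*(X₋ᵢ ∖ ∏_{j≠i} R^⋆ⱼ(μⱼ*)) = 0` for every player `i`. -/
theorem exists_equilibrium_possibility {n : ℕ} (X : Fin (n+1) → Type u)
    [∀ j, TopologicalSpace (X j)] [∀ j, CompactSpace (X j)] [∀ j, T2Space (X j)]
    [∀ j, Nonempty (X j)]
    (p : (∀ j, X j) → Fin (n+1) → ℝ) (hp : Continuous p)
    (hp01 : ∀ x j, p x j ∈ Icc (0:ℝ) 1)
    (star ast : Tnorm) (hstar : star.Cont) (hast : ast.Cont) :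
    ∃ μ : ∀ j, Capacity (X j), (∀ j, IsPossibility (μ j)) ∧
      ∃ μstar : ∀ j : Fin (n+1), Capacity (∀ k : Fin n, X (j.succAbove k)),
        (∀ j, IsPossTensorOff X ast μ j (μstar j)) ∧
        ∀ i : Fin (n+1),
          (μstar i).oval ((Set.univ.pi fun k : Fin n =>
            BestResp X p star (i.succAbove k) (μstar (i.succAbove k)))ᶜ) = 0 := by
  obtain ⟨d, hd1, hd2, hd3, hd4⟩ := stage2 X p hp star ast hstar hast
  let g : ∀ i : Fin (n+1), (∀ k : Fin n, X (i.succAbove k)) → ℝ := fun i y =>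
    ast.lp (List.finRange n) fun k => d _ (y k)
  have hg1 : ∀ i y, g i y ∈ Icc (0:ℝ) 1 := fun i y => ast.lp_mem _ _
  have hg2 : ∀ i, ∃ y, g i y = 1 := by
    intro i
    choose x hx using hd2
    exact ⟨fun k => x _, ast.lp_one _ _ fun k => hx _⟩
  have hg3 : ∀ i, UpperSemicontinuous (g i) := fun i =>
    lp_usc (fun k => X (i.succAbove k)) ast hast _ (fun k => d (i.succAbove k)) fun k => hd3 _
  let μ : ∀ j, Capacity (X j) := fun j => capOf (d j) (hd1 j) (hd2 j) (hd3 j)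
  let μs : ∀ j : Fin (n+1), Capacity (∀ k : Fin n, X (j.succAbove k)) := fun j =>
    capOf (g j) (hg1 j) (hg2 j) (hg3 j)
  have hμ : ∀ j x, (μ j).cval {x} = d j x := by
    intro j x
    simp only [μ]
    rw [capOf_cval _ _ _ _ _ isClosed_singleton, image_singleton, csSup_singleton]
  have hP : ∀ j x, Pexp X p star j x (μs j) =
      sSup (range fun y => qf X p star ast j x (fun k => d _ (y k)) y) := by
    intro j x
    refine capOf_tInt (g j) (hg1 j) (hg2 j) (hg3 j) star _ ?_ fun y => hp01 _ _
    exact (continuous_apply j).comp (hp.comp (continuous_const.finInsertNth j continuous_id))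
  have hbr : ∀ j x, 0 < d j x → x ∈ BestResp X p star j (μs j) := by
    intro j x hx
    have hle : ∀ z, Pexp X p star j z (μs j) ≤ Pexp X p star j x (μs j) := by
      intro z
      rw [hP, hP]
      refine csSup_le (range_nonempty _) ?_
      rintro _ ⟨y, rfl⟩
      refine le_of_forall_lt_imp_le_of_dense fun c hc => ?_
      obtain ⟨y', hy'⟩ := hd4 j x hx z y c hc
      exact hy'.trans (le_csSup ⟨1, by rintro _ ⟨w, rfl⟩; exact (star.ex_mem _ _).2⟩ ⟨y', rfl⟩)
    change Pexp X p star j x (μs j) = sSup (range fun z => Pexp X p star j z (μs j))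
    apply le_antisymm
    · exact le_csSup ⟨_, by rintro _ ⟨w, rfl⟩; exact hle w⟩ ⟨x, rfl⟩
    · exact csSup_le (range_nonempty _) (by rintro _ ⟨w, rfl⟩; exact hle w)
  refine ⟨μ, fun j => capOf_poss _ _ _ _, μs, ?_, ?_⟩
  · intro j B hB
    simp only [μs]
    rw [capOf_cval _ _ _ _ _ hB]
    have : g j = fun y : ∀ k : Fin n, X (j.succAbove k) =>
        ast.listProd ((List.finRange n).map fun k => (μ (j.succAbove k)).cval {y k}) := by
      funext y
      simp only [hμ, g, Tnorm.lp, cl01_of_mem (hd1 _ _)]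
    rw [this]
  · intro i
    have hz : ∀ K : Closeds (∀ k : Fin n, X (i.succAbove k)), (K : Set _) ⊆ (Set.univ.pi fun k : Fin n =>
            BestResp X p star (i.succAbove k) (μs (i.succAbove k)))ᶜ → (μs i).toFun K = 0 := by
      intro K hK
      change sSup (g i '' (K : Set _)) = 0
      have h0 : ∀ y ∈ (K : Set (∀ k : Fin n, X (i.succAbove k))), g i y = 0 := by
        intro y hy
        have h1 := hK hy
        simp only [mem_compl_iff, mem_pi, mem_univ, true_imp_iff, not_forall] at h1
        obtain ⟨k, hk⟩ := h1
        refine ast.lp_zero _ _ k (List.mem_finRange k) (le_antisymm ?_ (hd1 _ _).1)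
        by_contra hlt
        exact hk (hbr _ _ (not_le.1 hlt))
      apply le_antisymm
      · exact Real.sSup_le (by rintro _ ⟨y, hy, rfl⟩; exact (h0 y hy).le) le_rfl
      · exact Real.sSup_nonneg (by rintro _ ⟨y, hy, rfl⟩; exact (h0 y hy).ge)
    apply le_antisymm
    · exact Real.sSup_le (by rintro _ ⟨K, hK, rfl⟩; exact (hz K hK).le) le_rfl
    · exact Real.sSup_nonneg (by rintro _ ⟨K, hK, rfl⟩; exact (hz K hK).ge)
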